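/- Let H_X and H_Y be finite-dimensional complex Hilbert spaces with dim H_X = d_X, let μ be the Haar probability measure on the unitary group U(H_X), and let A be an operator on H_X ⊗ H_Y. Then ∫_{U(H_X)} (u ⊗ 1)† A (u ⊗ 1) dμ(u) = (1/d_X) · 1_{H_X} ⊗ tr_{H_X}(A), where tr_{H_X} denotes the partial trace over the factor H_X. -/

import Mathlib

open scoped Classical Kronecker Matrix
open MeasureTheory
noncomputable section

namespace CMI

attribute [local instance] Matrix.normedAddCommGroup Matrix.normedSpace

/-- Partial trace over the first tensor factor. -/
def ptraceFirst {X Y : Type*} [Fintype X]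
    (A : Matrix (X × Y) (X × Y) ℂ) : Matrix Y Y ℂ :=
  fun a b => ∑ x : X, A (x, a) (x, b)

/-- Multiplication by the fixed unitary `v` does not change second moments of the entries. -/
theorem integral_entry_mul_left
    {X : Type*} [Fintype X] [DecidableEq X]
    [MeasurableSpace (Matrix.unitaryGroup X ℂ)]
    [BorelSpace (Matrix.unitaryGroup X ℂ)]
    (μ : Measure (Matrix.unitaryGroup X ℂ)) [μ.IsMulLeftInvariant]
    (v : Matrix.unitaryGroup X ℂ) (i x k y : X) :
    ∫ u : Matrix.unitaryGroup X ℂ, star (((v : Matrix X X ℂ) * (u : Matrix X X ℂ)) i x) *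
        ((v : Matrix X X ℂ) * (u : Matrix X X ℂ)) k y ∂μ =
      ∫ u : Matrix.unitaryGroup X ℂ,
        star ((u : Matrix X X ℂ) i x) * (u : Matrix X X ℂ) k y ∂μ :=
  integral_mul_left_eq_self
    (fun u : Matrix.unitaryGroup X ℂ => star ((u : Matrix X X ℂ) i x) * (u : Matrix X X ℂ) k y) v

/-- Products of two entries of a unitary matrix are integrable. -/
theorem integrable_entry
    {X : Type*} [Fintype X] [DecidableEq X]
    [MeasurableSpace (Matrix.unitaryGroup X ℂ)]
    [BorelSpace (Matrix.unitaryGroup X ℂ)]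
    (μ : Measure (Matrix.unitaryGroup X ℂ)) [IsFiniteMeasure μ] (i x k y : X) :
    Integrable (fun u : Matrix.unitaryGroup X ℂ =>
      star ((u : Matrix X X ℂ) i x) * (u : Matrix X X ℂ) k y) μ := by
  have hc : Continuous (fun u : Matrix.unitaryGroup X ℂ =>
      star ((u : Matrix X X ℂ) i x) * (u : Matrix X X ℂ) k y) :=
    ((continuous_subtype_val.matrix_elem i x).star).mul (continuous_subtype_val.matrix_elem k y)
  refine Integrable.of_bound hc.aestronglyMeasurable 1 (Filter.Eventually.of_forall fun u => ?_)
  rw [norm_mul, norm_star]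
  exact mul_le_one₀ (entry_norm_bound_of_unitary u.2 i x) (norm_nonneg _)
    (entry_norm_bound_of_unitary u.2 k y)

theorem integral_entry_of_ne
    {X : Type*} [Fintype X] [DecidableEq X]
    [MeasurableSpace (Matrix.unitaryGroup X ℂ)]
    [BorelSpace (Matrix.unitaryGroup X ℂ)]
    (μ : Measure (Matrix.unitaryGroup X ℂ)) [μ.IsMulLeftInvariant]
    {i k : X} (hik : i ≠ k) (x y : X) :
    ∫ u : Matrix.unitaryGroup X ℂ,
      star ((u : Matrix X X ℂ) i x) * (u : Matrix X X ℂ) k y ∂μ = 0 := by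
  have hv : Matrix.diagonal (fun j : X => if j = i then (-1 : ℂ) else 1) ∈
      Matrix.unitaryGroup X ℂ := by
    rw [Matrix.mem_unitaryGroup_iff, Matrix.star_eq_conjTranspose, Matrix.diagonal_conjTranspose,
      Matrix.diagonal_mul_diagonal, ← Matrix.diagonal_one]
    congr 1
    funext j
    by_cases hj : j = i <;> simp [hj]
  have h := integral_entry_mul_left μ ⟨_, hv⟩ i x k y
  simp only [Matrix.diagonal_mul, if_true, if_neg hik.symm, neg_mul, one_mul, star_neg,
    integral_neg] at h
  exact self_eq_neg.mp h.symm

theorem integral_entry_diag_eq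
    {X : Type*} [Fintype X] [DecidableEq X]
    [MeasurableSpace (Matrix.unitaryGroup X ℂ)]
    [BorelSpace (Matrix.unitaryGroup X ℂ)]
    (μ : Measure (Matrix.unitaryGroup X ℂ)) [μ.IsMulLeftInvariant] (i k x y : X) :
    ∫ u : Matrix.unitaryGroup X ℂ,
        star ((u : Matrix X X ℂ) i x) * (u : Matrix X X ℂ) i y ∂μ =
      ∫ u : Matrix.unitaryGroup X ℂ,
        star ((u : Matrix X X ℂ) k x) * (u : Matrix X X ℂ) k y ∂μ := by
  have hv : (Equiv.swap i k).toPEquiv.toMatrix ∈ Matrix.unitaryGroup X ℂ := by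
    rw [Matrix.mem_unitaryGroup_iff, PEquiv.toMatrix_toPEquiv_mul]
    ext a b
    simp [Matrix.star_apply, PEquiv.toMatrix_apply, Matrix.one_apply, apply_ite, eq_comm]
  have h := integral_entry_mul_left μ ⟨_, hv⟩ k x k y
  simpa [PEquiv.toMatrix_toPEquiv_mul] using h

/-- Second moments of the entries of a Haar random unitary matrix. -/
theorem integral_entry
    {X : Type*} [Fintype X] [DecidableEq X]
    [MeasurableSpace (Matrix.unitaryGroup X ℂ)]
    [BorelSpace (Matrix.unitaryGroup X ℂ)]
    (μ : Measure (Matrix.unitaryGroup X ℂ)) [IsProbabilityMeasure μ]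
    [μ.IsMulLeftInvariant] (i x k y : X) :
    ∫ u : Matrix.unitaryGroup X ℂ,
        star ((u : Matrix X X ℂ) i x) * (u : Matrix X X ℂ) k y ∂μ =
      if i = k then (Fintype.card X : ℂ)⁻¹ * (1 : Matrix X X ℂ) x y else 0 := by
  split_ifs with hik
  · subst hik
    have hsum : ∑ j : X, ∫ u : Matrix.unitaryGroup X ℂ,
        star ((u : Matrix X X ℂ) j x) * (u : Matrix X X ℂ) j y ∂μ = (1 : Matrix X X ℂ) x y := by
      rw [← integral_finsetSum _ fun j _ => integrable_entry μ j x j y]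
      have h (u : Matrix.unitaryGroup X ℂ) :
          ∑ j : X, star ((u : Matrix X X ℂ) j x) * (u : Matrix X X ℂ) j y =
            (1 : Matrix X X ℂ) x y := by
        rw [← Matrix.UnitaryGroup.star_mul_self u]
        simp [Matrix.mul_apply, Matrix.star_apply]
      simp only [h, integral_const, probReal_univ, one_smul]
    rw [Finset.sum_congr rfl fun j _ => integral_entry_diag_eq μ j i x y] at hsum
    have hX : (Fintype.card X : ℂ) ≠ 0 := by
      have : Nonempty X := ⟨i⟩
      exact_mod_cast Fintype.card_ne_zero
    rw [Finset.sum_const, Finset.card_univ, nsmul_eq_mul] at hsum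
    rw [← hsum, inv_mul_cancel_left₀ hX]
  · exact integral_entry_of_ne μ hik x y

theorem conj_kronecker_one_apply
    {X Y : Type*} [Fintype X] [Fintype Y] [DecidableEq Y]
    (u : Matrix X X ℂ) (A : Matrix (X × Y) (X × Y) ℂ) (x y : X) (a b : Y) :
    ((u ⊗ₖ (1 : Matrix Y Y ℂ))ᴴ * A * (u ⊗ₖ (1 : Matrix Y Y ℂ))) (x, a) (y, b) =
      ∑ k : X, ∑ i : X, A (i, a) (k, b) * (star (u i x) * u k y) := by
  simp only [Matrix.mul_apply, Fintype.sum_prod_type, Matrix.conjTranspose_apply,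
    Matrix.kroneckerMap_apply, Matrix.one_apply, mul_ite, mul_one, mul_zero, apply_ite star,
    star_zero, ite_mul, zero_mul, Finset.sum_ite_eq', Finset.mem_univ, if_true, Finset.sum_mul]
  exact Finset.sum_congr rfl fun k _ => Finset.sum_congr rfl fun i _ => by ring

/-- Averaging `(u ⊗ 1)† A (u ⊗ 1)` over the Haar probability measure of
the unitary group of the first factor yields `(1/d_X) · 1 ⊗ tr_X(A)`. -/
theorem haar_average_eq_normalized_partial_trace
    {X Y : Type*} [Fintype X] [DecidableEq X] [Fintype Y] [DecidableEq Y]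
    [MeasurableSpace (Matrix.unitaryGroup X ℂ)]
    [BorelSpace (Matrix.unitaryGroup X ℂ)]
    (μ : Measure (Matrix.unitaryGroup X ℂ)) [IsProbabilityMeasure μ]
    [μ.IsMulLeftInvariant]
    (A : Matrix (X × Y) (X × Y) ℂ) :
    (∫ u : Matrix.unitaryGroup X ℂ,
        ((u : Matrix X X ℂ) ⊗ₖ (1 : Matrix Y Y ℂ))ᴴ * A *
          ((u : Matrix X X ℂ) ⊗ₖ (1 : Matrix Y Y ℂ)) ∂μ) =
      ((Fintype.card X : ℂ))⁻¹ • ((1 : Matrix X X ℂ) ⊗ₖ ptraceFirst A) := by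
  have hterm (x y i k : X) (a b : Y) : Integrable (fun u : Matrix.unitaryGroup X ℂ =>
      A (i, a) (k, b) * (star ((u : Matrix X X ℂ) i x) * (u : Matrix X X ℂ) k y)) μ :=
    (integrable_entry μ i x k y).const_mul _
  have hint (p q : X × Y) : Integrable (fun u : Matrix.unitaryGroup X ℂ =>
      (((u : Matrix X X ℂ) ⊗ₖ (1 : Matrix Y Y ℂ))ᴴ * A *
        ((u : Matrix X X ℂ) ⊗ₖ (1 : Matrix Y Y ℂ))) p q) μ := by
    obtain ⟨x, a⟩ := p
    obtain ⟨y, b⟩ := q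
    simp only [conj_kronecker_one_apply]
    exact integrable_finsetSum _ fun k _ => integrable_finsetSum _ fun i _ => hterm x y i k a b
  ext ⟨x, a⟩ ⟨y, b⟩
  refine (congrFun (eval_integral (fun p => Integrable.of_eval (hint p)) (x, a)) (y, b)).trans ?_
  refine (eval_integral (hint (x, a)) (y, b)).trans ?_
  simp only [conj_kronecker_one_apply]
  rw [integral_finsetSum _ fun k _ => integrable_finsetSum _ fun i _ => hterm x y i k a b]
  simp_rw [integral_finsetSum _ fun i _ => hterm x y i _ a b, integral_const_mul, integral_entry]
  simp only [mul_ite, mul_zero, Finset.sum_ite_eq', Finset.mem_univ, if_true, Matrix.smul_apply,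
    Matrix.kroneckerMap_apply, ptraceFirst, smul_eq_mul]
  rw [← Finset.sum_mul]
  ring

end CMI
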